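/- Let Y_1, …, Y_n and X_1, …, X_m be geodesic metric spaces, each containing more than one point, and suppose each factor has an integer bound on the number of geodesics joining any two of its points. Give Y = Y_1 × ⋯ × Y_n and X = X_1 × ⋯ × X_m the sup metrics. Then any surjective isometry F : Y → X maps the set { z ∈ Y : z_i ∈ S(Y_i) for some i } onto the set { w ∈ X : w_j ∈ S(X_j) for some j }; equivalently, F maps (Y_1 ∖ S(Y_1)) × ⋯ × (Y_n ∖ S(Y_n)) onto (X_1 ∖ S(X_1)) × ⋯ × (X_m ∖ S(X_m)). -/

import Mathlib

/-- The set of (globally length-minimizing, unit-speed) geodesics from `x` to `y` in a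
metric space: maps `γ : [0, dist x y] → X` with `γ 0 = x`, `γ (dist x y) = y`, and
`dist (γ s) (γ t) = |s - t|` for all `s, t`. -/
def GeodesicsFrom {X : Type*} [MetricSpace X] (x y : X) :
    Set (Set.Icc (0 : ℝ) (dist x y) → X) :=
  {γ | γ ⟨0, le_refl 0, dist_nonneg⟩ = x ∧
       γ ⟨dist x y, dist_nonneg, le_refl _⟩ = y ∧
       ∀ s t, dist (γ s) (γ t) = |s.1 - t.1|}

/-- A geodesic metric space: every two points are joined by at least one geodesic. -/
def IsGeodesicSpace (X : Type*) [MetricSpace X] : Prop :=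
  ∀ x y : X, (GeodesicsFrom x y).Nonempty

/-- `S(X)`: the set of points `z` of `X` every neighborhood of which contains two points
joined by more than one geodesic of `X`. -/
def BadSet (X : Type*) [MetricSpace X] : Set X :=
  {z | ∀ U ∈ nhds z, ∃ x ∈ U, ∃ y ∈ U, (GeodesicsFrom x y).Nontrivial}

/-- The 1-Lipschitz maps `[0, L] → X` that start at `x` and end at `y`. -/
def LipPaths {X : Type*} [MetricSpace X] {L : ℝ} (hL : 0 ≤ L) (x y : X) :
    Set (Set.Icc (0 : ℝ) L → X) :=
  {γ | γ ⟨0, le_refl 0, hL⟩ = x ∧ γ ⟨L, hL, le_refl _⟩ = y ∧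
    ∀ s t, dist (γ s) (γ t) ≤ |s.1 - t.1|}

/-- A 1-Lipschitz path on `[0, dist x y]` from `x` to `y` is a geodesic. -/
theorem geodesicsFrom_eq_lipPaths {X : Type*} [MetricSpace X] (x y : X) :
    GeodesicsFrom x y = LipPaths dist_nonneg x y := by
  ext γ
  refine ⟨fun h => ⟨h.1, h.2.1, fun s t => (h.2.2 s t).le⟩, fun h => ⟨h.1, h.2.1, ?_⟩⟩
  obtain ⟨h0, h1, hl⟩ := h
  have key : ∀ s t : Set.Icc (0 : ℝ) (dist x y), s.1 ≤ t.1 →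
      dist (γ s) (γ t) = |s.1 - t.1| := by
    intro s t hst
    refine le_antisymm (hl s t) ?_
    have e0 := hl ⟨0, le_refl 0, dist_nonneg⟩ s
    have e1 := hl t ⟨dist x y, dist_nonneg, le_refl _⟩
    rw [h0, abs_of_nonpos (by simpa using s.2.1)] at e0
    rw [h1, abs_of_nonpos (by simpa using t.2.2)] at e1
    rw [abs_of_nonpos (by linarith)]
    have := dist_triangle4 x (γ s) (γ t) y
    simp only at e0 e1
    linarith
  intro s t
  rcases le_total s.1 t.1 with h | h
  · exact key s t h
  · rw [dist_comm, abs_sub_comm, key t s h]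

theorem geodesicsFrom_finite_iff {X : Type*} [MetricSpace X] {x y : X} {L : ℝ} (hL : 0 ≤ L)
    (h : dist x y = L) : (GeodesicsFrom x y).Finite ↔ (LipPaths hL x y).Finite := by
  subst h
  rw [geodesicsFrom_eq_lipPaths]

theorem geodesicsFrom_nontrivial_iff {X : Type*} [MetricSpace X] {x y : X} {L : ℝ} (hL : 0 ≤ L)
    (h : dist x y = L) : (GeodesicsFrom x y).Nontrivial ↔ (LipPaths hL x y).Nontrivial := by
  subst h
  rw [geodesicsFrom_eq_lipPaths]

/-- In a geodesic space a geodesic extends, constantly beyond its ends, to a 1-Lipschitz map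
on the real line. -/
theorem IsGeodesicSpace.exists_extension {X : Type*} [MetricSpace X] (hX : IsGeodesicSpace X)
    (a b : X) : ∃ g : ℝ → X, (∀ u ≤ 0, g u = a) ∧ (∀ u, dist a b ≤ u → g u = b) ∧
      (∀ u v, dist (g u) (g v) ≤ |u - v|) ∧
      ∀ u ∈ Set.Icc 0 (dist a b), ∀ v ∈ Set.Icc 0 (dist a b), dist (g u) (g v) = |u - v| := by
  obtain ⟨γ, h0, h1, hl⟩ := hX a b
  refine ⟨Set.IccExtend dist_nonneg γ, fun u hu => ?_, fun u hu => ?_, fun u v => ?_,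
    fun u hu v hv => ?_⟩
  · rw [Set.IccExtend_of_le_left _ _ hu, h0]
  · rw [Set.IccExtend_of_right_le _ _ hu, h1]
  · simp only [Set.IccExtend, Function.comp, hl]
    exact Set.abs_projIcc_sub_projIcc dist_nonneg
  · rw [Set.IccExtend_of_mem _ _ hu, Set.IccExtend_of_mem _ _ hv, hl]

theorem IsGeodesicSpace.lipPaths_nonempty {X : Type*} [MetricSpace X] (hX : IsGeodesicSpace X)
    {a b : X} {L : ℝ} (hL : 0 ≤ L) (h : dist a b ≤ L) : (LipPaths hL a b).Nonempty := by
  obtain ⟨g, h0, h1, hl, -⟩ := hX.exists_extension a b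
  exact ⟨fun t => g t, h0 0 le_rfl, h1 L h, fun s t => hl s t⟩

theorem IsGeodesicSpace.lipPaths_infinite {X : Type*} [MetricSpace X] [Nontrivial X]
    (hX : IsGeodesicSpace X) {a b : X} {L : ℝ} (hL : 0 ≤ L) (h : dist a b < L) :
    (LipPaths hL a b).Infinite := by
  rcases eq_or_ne a b with rfl | hab
  · rw [dist_self] at h
    obtain ⟨p, hp⟩ := exists_ne a
    obtain ⟨g, h0, -, hl, hg⟩ := hX.exists_extension a p
    have hD : 0 < dist a p := dist_pos.2 hp.symm
    have hinf := Set.Icc_infinite (lt_min (half_pos h) hD)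
    refine Set.infinite_of_injOn_mapsTo (f := fun c t => g (min (min t.1 (L - t.1)) c))
      ?_ ?_ hinf
    · intro c hc c' hc' hcc
      simp only [Set.mem_Icc, le_min_iff] at hc hc'
      have := congrFun hcc ⟨L / 2, by linarith, by linarith⟩
      simp only at this
      rw [sub_half, min_self, min_eq_right hc.2.1, min_eq_right hc'.2.1,
        ← dist_eq_zero, hg c ⟨hc.1, hc.2.2⟩ c' ⟨hc'.1, hc'.2.2⟩, abs_eq_zero] at this
      linarith
    · intro c hc
      refine ⟨h0 _ ?_, h0 _ ?_, fun s t => (hl _ _).trans ?_⟩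
      · simp
      · simp
      · rw [abs_le]
        have h1 := le_abs_self (s.1 - t.1)
        have h2 := neg_abs_le (s.1 - t.1)
        constructor <;> simp only [min_def] <;> split_ifs <;> linarith
  · obtain ⟨g, h0, h1, hl, hg⟩ := hX.exists_extension a b
    have hD : 0 < dist a b := dist_pos.2 hab
    have hinf := Set.Icc_infinite (lt_min (sub_pos.2 h) hD)
    refine Set.infinite_of_injOn_mapsTo (f := fun c t => g (t.1 - c)) ?_ ?_ hinf
    · intro c hc c' hc' hcc
      simp only [Set.mem_Icc, le_min_iff] at hc hc'
      have := congrFun hcc ⟨dist a b, hD.le, h.le⟩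
      simp only at this
      rw [← dist_eq_zero, hg _ ⟨by linarith, by linarith⟩ _ ⟨by linarith, by linarith⟩,
        abs_eq_zero] at this
      linarith
    · intro c hc
      simp only [Set.mem_Icc, le_min_iff] at hc
      refine ⟨h0 _ ?_, h1 _ ?_, fun s t => (hl _ _).trans (le_of_eq ?_)⟩
      · simpa using hc.1
      · linarith
      · congr 1
        ring

/-- In a nontrivial geodesic space, every point has points at any small enough distance. -/
theorem IsGeodesicSpace.exists_dist_eq {X : Type*} [MetricSpace X] [Nontrivial X]
    (hX : IsGeodesicSpace X) (a : X) :
    ∃ D > 0, ∀ r ∈ Set.Icc 0 D, ∃ b, dist a b = r := by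
  obtain ⟨p, hp⟩ := exists_ne a
  obtain ⟨g, h0, -, -, hg⟩ := hX.exists_extension a p
  refine ⟨dist a p, dist_pos.2 hp.symm, fun r hr => ⟨g r, ?_⟩⟩
  have := hg 0 ⟨le_rfl, dist_nonneg⟩ r hr
  rwa [h0 0 le_rfl, zero_sub, abs_neg, abs_of_nonneg hr.1] at this

theorem mem_lipPaths_pi {ι : Type*} [Fintype ι] {Y : ι → Type*} [∀ i, MetricSpace (Y i)]
    {L : ℝ} (hL : 0 ≤ L) {x y : ∀ i, Y i} {γ : Set.Icc (0 : ℝ) L → ∀ i, Y i} :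
    γ ∈ LipPaths hL x y ↔ ∀ i, (fun t => γ t i) ∈ LipPaths hL (x i) (y i) := by
  constructor
  · rintro ⟨h0, h1, hl⟩ i
    exact ⟨congrFun h0 i, congrFun h1 i, fun s t => (dist_le_pi_dist _ _ i).trans (hl s t)⟩
  · intro h
    exact ⟨funext fun i => (h i).1, funext fun i => (h i).2.1,
      fun s t => (dist_pi_le_iff (abs_nonneg _)).2 fun i => (h i).2.2 s t⟩

/-- The points every neighborhood of which contains two points joined by more than one, but
only finitely many, geodesics. -/
def FinitelyBadSet (X : Type*) [MetricSpace X] : Set X :=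
  {z | ∀ U ∈ nhds z, ∃ x ∈ U, ∃ y ∈ U, (GeodesicsFrom x y).Nontrivial ∧
    (GeodesicsFrom x y).Finite}

section Product

variable {ι : Type*} [Fintype ι] {Y : ι → Type*} [∀ i, MetricSpace (Y i)]

/-- If two points of a sup-metric product are joined by finitely many geodesics, then all their
coordinate distances agree. -/
theorem dist_eq_of_geodesicsFrom_finite [∀ i, Nontrivial (Y i)]
    (hY : ∀ i, IsGeodesicSpace (Y i)) {x y : ∀ i, Y i} (h : (GeodesicsFrom x y).Finite) (i : ι) :
    dist (x i) (y i) = dist x y := by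
  classical
  refine (dist_le_pi_dist x y i).antisymm (not_lt.1 fun hlt => ?_)
  rw [geodesicsFrom_eq_lipPaths] at h
  have hinf := (hY i).lipPaths_infinite dist_nonneg hlt
  choose γ hγ using fun j => (hY j).lipPaths_nonempty dist_nonneg (dist_le_pi_dist x y j)
  refine Set.infinite_of_injOn_mapsTo
    (f := fun δ t j => Function.update γ i δ j t) ?_ ?_ hinf h
  · intro δ _ δ' _ hd
    ext t
    simpa using congrFun (congrFun hd t) i
  · intro δ hδ
    refine (mem_lipPaths_pi dist_nonneg).2 fun j => ?_
    rcases eq_or_ne j i with rfl | hj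
    · simpa using hδ
    · simpa [hj] using hγ j

theorem exists_geodesicsFrom_nontrivial [∀ i, Nontrivial (Y i)]
    (hY : ∀ i, IsGeodesicSpace (Y i)) {x y : ∀ i, Y i} (h : (GeodesicsFrom x y).Finite)
    (h' : (GeodesicsFrom x y).Nontrivial) : ∃ i, (GeodesicsFrom (x i) (y i)).Nontrivial := by
  rw [geodesicsFrom_eq_lipPaths x y] at h'
  obtain ⟨γ, hγ, δ, hδ, hne⟩ := h'
  obtain ⟨i, hi⟩ : ∃ i, (fun t => γ t i) ≠ fun t => δ t i := by
    by_contra! hcon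
    exact hne (funext fun t => funext fun i => congrFun (hcon i) t)
  refine ⟨i, (geodesicsFrom_nontrivial_iff dist_nonneg
    (dist_eq_of_geodesicsFrom_finite hY h i)).2 ?_⟩
  exact ⟨_, (mem_lipPaths_pi _).1 hγ i, _, (mem_lipPaths_pi _).1 hδ i, hi⟩

theorem geodesicsFrom_pi_finite {x y : ∀ i, Y i}
    (hfin : ∀ i, (GeodesicsFrom (x i) (y i)).Finite)
    (hd : ∀ i, dist (x i) (y i) = dist x y) : (GeodesicsFrom x y).Finite := by
  rw [geodesicsFrom_eq_lipPaths]
  refine Set.Finite.of_injOn (f := fun γ i t => γ t i) ?_ ?_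
    (Set.Finite.pi' fun i => (geodesicsFrom_finite_iff dist_nonneg (hd i)).1 (hfin i))
  · exact fun γ hγ i => (mem_lipPaths_pi _).1 hγ i
  · exact fun γ _ δ _ h => funext fun t => funext fun i => congrFun (congrFun h i) t

theorem geodesicsFrom_pi_nontrivial (hY : ∀ i, IsGeodesicSpace (Y i)) {x y : ∀ i, Y i}
    (hd : ∀ i, dist (x i) (y i) = dist x y) {i : ι}
    (h : (GeodesicsFrom (x i) (y i)).Nontrivial) : (GeodesicsFrom x y).Nontrivial := by
  classical
  rw [geodesicsFrom_nontrivial_iff dist_nonneg (hd i)] at h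
  rw [geodesicsFrom_eq_lipPaths]
  choose γ hγ using fun j => (hY j).lipPaths_nonempty dist_nonneg (hd j).le
  have key : ∀ δ ∈ LipPaths dist_nonneg (x i) (y i),
      (fun t j => Function.update γ i δ j t) ∈ LipPaths dist_nonneg x y := by
    intro δ hδ
    refine (mem_lipPaths_pi dist_nonneg).2 fun j => ?_
    rcases eq_or_ne j i with rfl | hj
    · simpa using hδ
    · simpa [hj] using hγ j
  obtain ⟨δ, hδ, δ', hδ', hne⟩ := h
  refine ⟨_, key δ hδ, _, key δ' hδ', fun heq => hne ?_⟩
  ext t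
  simpa using congrFun (congrFun heq t) i

theorem finitelyBadSet_pi [∀ i, Nontrivial (Y i)] (hY : ∀ i, IsGeodesicSpace (Y i))
    (hfin : ∀ i, ∀ x y : Y i, (GeodesicsFrom x y).Finite) :
    FinitelyBadSet (∀ i, Y i) = {z | ∃ i, z i ∈ BadSet (Y i)} := by
  classical
  ext z
  constructor
  · intro hz
    by_contra hcon
    simp only [Set.mem_ofPred_eq, not_exists, BadSet, not_forall] at hcon
    choose U hU hbad using hcon
    obtain ⟨x, hx, y, hy, hnt, hf⟩ :=
      hz (Set.univ.pi U) (set_pi_mem_nhds Set.finite_univ fun i _ => hU i)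
    obtain ⟨i, hi⟩ := exists_geodesicsFrom_nontrivial hY hf hnt
    exact hbad i (x i) ⟨hx i trivial, y i, hy i trivial, hi⟩
  · rintro ⟨i, hi⟩ U hU
    obtain ⟨ε, hε, hεU⟩ := Metric.mem_nhds_iff.1 hU
    choose D hD hDr using fun j => (hY j).exists_dist_eq (z j)
    obtain ⟨ρ, hρ, hρD⟩ : ∃ ρ > 0, ∀ j, ρ ≤ D j := by
      have : Nonempty ι := ⟨i⟩
      obtain ⟨j, hj⟩ := Finite.exists_min D
      exact ⟨D j, hD j, hj⟩
    have hη : 0 < min ε ρ / 2 := half_pos (lt_min hε hρ)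
    obtain ⟨a, ha, b, hb, hab⟩ := hi _ (Metric.ball_mem_nhds (z i) hη)
    rw [Metric.mem_ball] at ha hb
    have hdab : dist a b < min ε ρ := by
      have := dist_triangle_right a b (z i)
      linarith
    choose w hw using fun j => hDr j (dist a b)
      ⟨dist_nonneg, (hdab.le.trans (min_le_right _ _)).trans (hρD j)⟩
    have hηε : min ε ρ / 2 < ε := by
      have := min_le_left ε ρ
      linarith
    have hd : ∀ j, dist (Function.update z i a j) (Function.update w i b j) = dist a b := by
      intro j
      rcases eq_or_ne j i with rfl | hj
      · simp
      · simpa [hj] using hw j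
    have hd' : ∀ j, dist (Function.update z i a j) (Function.update w i b j) =
        dist (Function.update z i a) (Function.update w i b) := by
      intro j
      exact (dist_le_pi_dist _ _ j).antisymm
        ((dist_pi_le_iff dist_nonneg).2 fun k => ((hd k).trans (hd j).symm).le)
    refine ⟨Function.update z i a, hεU ?_, Function.update w i b, hεU ?_,
      geodesicsFrom_pi_nontrivial hY hd' (i := i)
        (by rwa [Function.update_self, Function.update_self]),
      geodesicsFrom_pi_finite (fun j => hfin j _ _) hd'⟩
    · rw [Metric.mem_ball, dist_pi_lt_iff hε]
      intro j
      rcases eq_or_ne j i with rfl | hj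
      · simpa using ha.trans hηε
      · simpa [hj] using hε
    · rw [Metric.mem_ball, dist_pi_lt_iff hε]
      intro j
      rcases eq_or_ne j i with rfl | hj
      · simpa using hb.trans hηε
      · simpa [hj, dist_comm, hw j] using hdab.trans_le (min_le_left _ _)

end Product

theorem IsometryEquiv.image_lipPaths {X Y : Type*} [MetricSpace X] [MetricSpace Y] (e : X ≃ᵢ Y)
    {L : ℝ} (hL : 0 ≤ L) (x y : X) :
    (fun γ => e ∘ γ) '' LipPaths hL x y = LipPaths hL (e x) (e y) := by
  ext γ
  constructor
  · rintro ⟨δ, ⟨h0, h1, hl⟩, rfl⟩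
    exact ⟨congrArg e h0, congrArg e h1, fun s t => (e.dist_eq _ _).trans_le (hl s t)⟩
  · rintro ⟨h0, h1, hl⟩
    refine ⟨e.symm ∘ γ, ⟨by simp [h0], by simp [h1],
      fun s t => (e.symm.dist_eq _ _).trans_le (hl s t)⟩, ?_⟩
    ext t
    simp

theorem IsometryEquiv.mem_finitelyBadSet {X Y : Type*} [MetricSpace X] [MetricSpace Y]
    (e : X ≃ᵢ Y) {z : X} (hz : z ∈ FinitelyBadSet X) : e z ∈ FinitelyBadSet Y := by
  intro U hU
  obtain ⟨x, hx, y, hy, hnt, hf⟩ := hz (e ⁻¹' U) (e.continuous.continuousAt hU)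
  refine ⟨e x, hx, e y, hy, ?_, ?_⟩
  · rw [geodesicsFrom_nontrivial_iff dist_nonneg (e.dist_eq x y), ← e.image_lipPaths]
    rw [geodesicsFrom_eq_lipPaths] at hnt
    exact hnt.image e.injective.comp_left
  · rw [geodesicsFrom_finite_iff dist_nonneg (e.dist_eq x y), ← e.image_lipPaths]
    rw [geodesicsFrom_eq_lipPaths] at hf
    exact hf.image _

theorem IsometryEquiv.image_finitelyBadSet {X Y : Type*} [MetricSpace X] [MetricSpace Y]
    (e : X ≃ᵢ Y) : e '' FinitelyBadSet X = FinitelyBadSet Y := by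
  refine Set.Subset.antisymm ?_ fun w hw => ⟨e.symm w, e.symm.mem_finitelyBadSet hw, by simp⟩
  rintro _ ⟨z, hz, rfl⟩
  exact e.mem_finitelyBadSet hz

/-- Any surjective isometry between sup-metric products of nontrivial geodesic metric
spaces, each factor having an integer bound on the number of geodesics joining any two
of its points, maps `{z | ∃ i, z i ∈ S(Y i)}` onto `{w | ∃ j, w j ∈ S(X j)}`;
equivalently, it maps `∏ (Yᵢ ∖ S(Yᵢ))` onto `∏ (Xⱼ ∖ S(Xⱼ))`. -/
theorem isometry_maps_badSet_onto_badSet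
    {n m : ℕ} (Y : Fin n → Type*) (X : Fin m → Type*)
    [∀ i, MetricSpace (Y i)] [∀ j, MetricSpace (X j)]
    [∀ i, Nontrivial (Y i)] [∀ j, Nontrivial (X j)]
    (hYgeo : ∀ i, IsGeodesicSpace (Y i)) (hXgeo : ∀ j, IsGeodesicSpace (X j))
    (hYbound : ∀ i, ∃ N : ℕ, 1 ≤ N ∧ ∀ x y : Y i,
      (GeodesicsFrom x y).Finite ∧ (GeodesicsFrom x y).ncard ≤ N)
    (hXbound : ∀ j, ∃ N : ℕ, 1 ≤ N ∧ ∀ x y : X j,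
      (GeodesicsFrom x y).Finite ∧ (GeodesicsFrom x y).ncard ≤ N)
    (F : (∀ i, Y i) → (∀ j, X j)) (hF : Isometry F)
    (hsurj : Function.Surjective F) :
    F '' {z | ∃ i, z i ∈ BadSet (Y i)} = {w | ∃ j, w j ∈ BadSet (X j)} ∧
    F '' {z | ∀ i, z i ∉ BadSet (Y i)} = {w | ∀ j, w j ∉ BadSet (X j)} := by
  have h : F '' {z | ∃ i, z i ∈ BadSet (Y i)} = {w | ∃ j, w j ∈ BadSet (X j)} := by
    rw [← finitelyBadSet_pi hYgeo fun i x y => ((hYbound i).choose_spec.2 x y).1,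
      ← finitelyBadSet_pi hXgeo fun j x y => ((hXbound j).choose_spec.2 x y).1]
    exact (IsometryEquiv.mk (Equiv.ofBijective F ⟨hF.injective, hsurj⟩) hF).image_finitelyBadSet
  refine ⟨h, ?_⟩
  have hcompl := Set.image_compl_eq (s := {z | ∃ i, z i ∈ BadSet (Y i)}) ⟨hF.injective, hsurj⟩
  rw [h] at hcompl
  simpa only [Set.compl_ofPred, not_exists] using hcompl
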